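/- Let (C•,d_C), (D•,d_D) be cochain complexes in 𝒞 with fixed lifts (C̄•,d̄_C), (D̄•,d̄_D) along F; write δ̄ = δ_{d̄_C,d̄_D}. Let f, g : C• → D• be graded maps of degree n, H, K : f → g two homotopies, and Λ : H → K a homotopy of homotopies (a graded map of degree n−2 with δ(Λ) = K − H). Suppose f̄, ḡ are graded lifts of f, g with δ̄(f̄) = δ̄(ḡ). Then: (i) for any graded lifts H̄ of H and K̄ of K, δ̄(K̄) − δ̄(H̄) = δ̄(γ) for some graded map γ with F(γ) = 0, so the obstruction classes of H and K against lifting to homotopies f̄ → ḡ coincide; and (ii) if these obstructions vanish, then for every graded lift H̄ of H with δ̄(H̄) = ḡ − f̄ there exists a graded lift K̄ of K with δ̄(K̄) = ḡ − f̄ together with a graded lift Λ̄ of Λ satisfying δ̄(Λ̄) = K̄ − H̄. -/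

import Mathlib

open CategoryTheory

namespace Paper

/-- A graded object: a `ℤ`-indexed family of objects. -/
abbrev GradedObj (A : Type*) [Category A] := ℤ → A

/-- A graded map of degree `n` from `X` to `Y`. -/
abbrev GMap {A : Type*} [Category A] (X Y : GradedObj A) (n : ℤ) :=
  ∀ i : ℤ, X i ⟶ Y (i + n)

/-- Composition of graded maps, in diagrammatic order (`gcomp h f g` is "`g ∘ f`"),
with prescribed total degree `k = n + m`. -/
def gcomp {A : Type*} [Category A] {X Y Z : GradedObj A} {n m k : ℤ} (h : n + m = k)
    (f : GMap X Y n) (g : GMap Y Z m) : GMap X Z k :=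
  fun i => f i ≫ g (i + n) ≫ eqToHom (congrArg Z (show i + n + m = i + k by omega))

/-- The identity graded map of degree `0`. -/
def gid {A : Type*} [Category A] (X : GradedObj A) : GMap X X 0 :=
  fun i => eqToHom (congrArg X (add_zero i).symm)

/-- `δ(f) = d_Y ∘ f - (-1)ⁿ ⬝ f ∘ d_X` for pre-differentials `d_X`, `d_Y` and a graded
map `f` of degree `n`; the result has degree `m = n + 1`. -/
def gdelta {A : Type*} [Category A] [Preadditive A] {X Y : GradedObj A}
    (dX : GMap X X 1) (dY : GMap Y Y 1) {n m : ℤ} (h : n + 1 = m) (f : GMap X Y n) :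
    GMap X Y m :=
  gcomp h f dY - (n.negOnePow : ℤ) • gcomp (show 1 + n = m by omega) dX f

/-- The image of a graded object under a functor. -/
abbrev Fgr {A B : Type*} [Category A] [Category B] (F : B ⥤ A) (X : GradedObj B) :
    GradedObj A := fun i => F.obj (X i)

/-- The image of a graded map under a functor. -/
def Fmap {A B : Type*} [Category A] [Category B] (F : B ⥤ A) {X Y : GradedObj B} {n : ℤ}
    (f : GMap X Y n) : GMap (Fgr F X) (Fgr F Y) n := fun i => F.map (f i)

/-- `Ker(F)² = 0`: the composite of two `F`-killed morphisms vanishes. -/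
def KerSq {A B : Type*} [Category A] [Category B] [Preadditive A] [Preadditive B]
    (F : B ⥤ A) : Prop :=
  ∀ ⦃X Y Z : B⦄ (u : X ⟶ Y) (v : Y ⟶ Z), F.map u = 0 → F.map v = 0 → u ≫ v = 0

/-- `f : (X,dX) → (Y,dY)` and `g : (Y,dY) → (X,dX)` are cochain maps which are homotopy
inverse to each other. -/
def IsHomotopyEquivPair {A : Type*} [Category A] [Preadditive A] {X Y : GradedObj A}
    (dX : GMap X X 1) (dY : GMap Y Y 1) (f : GMap X Y 0) (g : GMap Y X 0) : Prop :=
  gdelta dX dY (show (0:ℤ) + 1 = 1 by omega) f = 0 ∧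
  gdelta dY dX (show (0:ℤ) + 1 = 1 by omega) g = 0 ∧
  (∃ H : GMap X X (-1), gdelta dX dX (show (-1:ℤ) + 1 = 0 by omega) H
      = gid X - gcomp (show (0:ℤ) + 0 = 0 by omega) f g) ∧
  (∃ K : GMap Y Y (-1), gdelta dY dY (show (-1:ℤ) + 1 = 0 by omega) K
      = gid Y - gcomp (show (0:ℤ) + 0 = 0 by omega) g f)


section GradedMaps

variable {A : Type*} [Category A]

theorem eqToHom_comp_gmap {X Y : GradedObj A} {n : ℤ} (f : GMap X Y n) {i j : ℤ} (h : i = j) :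
    eqToHom (congrArg X h) ≫ f j = f i ≫ eqToHom (congrArg (fun k => Y (k + n)) h) := by
  subst h
  simp

theorem gcomp_assoc {X Y Z W : GradedObj A} {n m k a b c : ℤ}
    (hnm : n + m = a) (hak : a + k = c) (hmk : m + k = b) (hnb : n + b = c)
    (f : GMap X Y n) (g : GMap Y Z m) (h : GMap Z W k) :
    gcomp hak (gcomp hnm f g) h = gcomp hnb f (gcomp hmk g h) := by
  funext i
  have e := eqToHom_comp_gmap h (show i + n + m = i + a by omega)
  simp only [gcomp, Category.assoc]
  rw [reassoc_of% e]
  simp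

variable [Preadditive A]

theorem gcomp_zero {X Y Z : GradedObj A} {n m k : ℤ} (h : n + m = k) (f : GMap X Y n) :
    gcomp h f (0 : GMap Y Z m) = 0 := by
  funext i
  simp [gcomp]

theorem zero_gcomp {X Y Z : GradedObj A} {n m k : ℤ} (h : n + m = k) (g : GMap Y Z m) :
    gcomp h (0 : GMap X Y n) g = 0 := by
  funext i
  simp [gcomp]

theorem gcomp_add {X Y Z : GradedObj A} {n m k : ℤ} (h : n + m = k) (f : GMap X Y n)
    (g g' : GMap Y Z m) : gcomp h f (g + g') = gcomp h f g + gcomp h f g' := by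
  funext i
  simp [gcomp]

theorem add_gcomp {X Y Z : GradedObj A} {n m k : ℤ} (h : n + m = k) (f f' : GMap X Y n)
    (g : GMap Y Z m) : gcomp h (f + f') g = gcomp h f g + gcomp h f' g := by
  funext i
  simp [gcomp]

theorem gcomp_sub {X Y Z : GradedObj A} {n m k : ℤ} (h : n + m = k) (f : GMap X Y n)
    (g g' : GMap Y Z m) : gcomp h f (g - g') = gcomp h f g - gcomp h f g' := by
  funext i
  simp [gcomp]

theorem sub_gcomp {X Y Z : GradedObj A} {n m k : ℤ} (h : n + m = k) (f f' : GMap X Y n)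
    (g : GMap Y Z m) : gcomp h (f - f') g = gcomp h f g - gcomp h f' g := by
  funext i
  simp [gcomp]

theorem gcomp_zsmul {X Y Z : GradedObj A} {n m k : ℤ} (h : n + m = k) (f : GMap X Y n)
    (r : ℤ) (g : GMap Y Z m) : gcomp h f (r • g) = r • gcomp h f g := by
  funext i
  simp [gcomp]

theorem zsmul_gcomp {X Y Z : GradedObj A} {n m k : ℤ} (h : n + m = k) (r : ℤ) (f : GMap X Y n)
    (g : GMap Y Z m) : gcomp h (r • f) g = r • gcomp h f g := by
  funext i
  simp [gcomp]

theorem gdelta_add {X Y : GradedObj A} (dX : GMap X X 1) (dY : GMap Y Y 1) {n m : ℤ}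
    (h : n + 1 = m) (f g : GMap X Y n) :
    gdelta dX dY h (f + g) = gdelta dX dY h f + gdelta dX dY h g := by
  simp only [gdelta, gcomp_add, add_gcomp, smul_add]
  abel

theorem gdelta_sub {X Y : GradedObj A} (dX : GMap X X 1) (dY : GMap Y Y 1) {n m : ℤ}
    (h : n + 1 = m) (f g : GMap X Y n) :
    gdelta dX dY h (f - g) = gdelta dX dY h f - gdelta dX dY h g := by
  simp only [gdelta, gcomp_sub, sub_gcomp, smul_sub]
  abel

theorem gdelta_gdelta {X Y : GradedObj A} {dX : GMap X X 1} {dY : GMap Y Y 1}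
    (h₂ : (1 : ℤ) + 1 = 2) (hdX : gcomp h₂ dX dX = 0) (hdY : gcomp h₂ dY dY = 0)
    {n m k : ℤ} (h : n + 1 = m) (h' : m + 1 = k) (f : GMap X Y n) :
    gdelta dX dY h' (gdelta dX dY h f) = 0 := by
  have hn2 : n + 2 = k := by omega
  have h2n : 2 + n = k := by omega
  have hsign : (m.negOnePow : ℤ) = -(n.negOnePow : ℤ) := by
    rw [← h, Int.negOnePow_succ, Units.val_neg]
  simp only [gdelta, gcomp_sub, sub_gcomp, gcomp_zsmul, zsmul_gcomp, hsign]
  rw [gcomp_assoc _ _ h₂ hn2 f dY dY, hdY, gcomp_zero,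
    ← gcomp_assoc h₂ h2n _ _ dX dX f, hdX, zero_gcomp,
    gcomp_assoc _ _ h (show 1 + m = k by omega) dX f dY]
  simp

end GradedMaps

section Functoriality

variable {A B : Type*} [Category A] [Category B] (F : B ⥤ A)

theorem Fmap_gcomp {X Y Z : GradedObj B} {n m k : ℤ} (h : n + m = k) (f : GMap X Y n)
    (g : GMap Y Z m) : Fmap F (gcomp h f g) = gcomp h (Fmap F f) (Fmap F g) := by
  funext i
  simp [gcomp, Fmap, eqToHom_map]

theorem exists_Fmap_eq [F.Full] {X Y : GradedObj B} {n : ℤ} (f : GMap (Fgr F X) (Fgr F Y) n) :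
    ∃ f' : GMap X Y n, Fmap F f' = f :=
  ⟨fun i => F.preimage (f i), funext fun i => F.map_preimage (f i)⟩

variable [Preadditive A] [Preadditive B] [F.Additive]

theorem Fmap_add {X Y : GradedObj B} {n : ℤ} (f g : GMap X Y n) :
    Fmap F (f + g) = Fmap F f + Fmap F g :=
  funext fun _ => F.map_add

theorem Fmap_sub {X Y : GradedObj B} {n : ℤ} (f g : GMap X Y n) :
    Fmap F (f - g) = Fmap F f - Fmap F g :=
  funext fun _ => F.map_sub

theorem Fmap_zsmul {X Y : GradedObj B} {n : ℤ} (r : ℤ) (f : GMap X Y n) :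
    Fmap F (r • f) = r • Fmap F f :=
  funext fun _ => F.map_zsmul

theorem Fmap_gdelta {X Y : GradedObj B} (dX : GMap X X 1) (dY : GMap Y Y 1) {n m : ℤ}
    (h : n + 1 = m) (f : GMap X Y n) :
    Fmap F (gdelta dX dY h f) = gdelta (Fmap F dX) (Fmap F dY) h (Fmap F f) := by
  simp only [gdelta, Fmap_sub, Fmap_zsmul, Fmap_gcomp]

end Functoriality

/-- Proposition `comp`(1): homotopic homotopies have the same obstruction
against lifting, and when the obstruction vanishes a lifted homotopy for `H` can be
matched by a lifted homotopy for `K` which is moreover homotopic to it via a lift of the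
given homotopy of homotopies `Λ`. -/
theorem statement12 {B C : Type*} [Category B] [Preadditive B] [Category C] [Preadditive C]
    (F : B ⥤ C) [F.Additive] [F.Full] (hF : KerSq F)
    (Xb Yb : GradedObj B)
    (dC : GMap (Fgr F Xb) (Fgr F Xb) 1) (dD : GMap (Fgr F Yb) (Fgr F Yb) 1)
    (hdC : gcomp (show (1:ℤ) + 1 = 2 by omega) dC dC = 0)
    (hdD : gcomp (show (1:ℤ) + 1 = 2 by omega) dD dD = 0)
    (dCb : GMap Xb Xb 1) (hdCb : Fmap F dCb = dC)
    (hdCbsq : gcomp (show (1:ℤ) + 1 = 2 by omega) dCb dCb = 0)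
    (dDb : GMap Yb Yb 1) (hdDb : Fmap F dDb = dD)
    (hdDbsq : gcomp (show (1:ℤ) + 1 = 2 by omega) dDb dDb = 0)
    (n : ℤ) (f g : GMap (Fgr F Xb) (Fgr F Yb) n)
    (H K : GMap (Fgr F Xb) (Fgr F Yb) (n - 1))
    (hH : gdelta dC dD (show n - 1 + 1 = n by omega) H = g - f)
    (hK : gdelta dC dD (show n - 1 + 1 = n by omega) K = g - f)
    (Λ : GMap (Fgr F Xb) (Fgr F Yb) (n - 2))
    (hΛ : gdelta dC dD (show n - 2 + 1 = n - 1 by omega) Λ = K - H)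
    (fb gb : GMap Xb Yb n) (hfb : Fmap F fb = f) (hgb : Fmap F gb = g)
    (hdel : gdelta dCb dDb rfl fb = gdelta dCb dDb rfl gb) :
    -- (i) the two obstructions coincide
    (∀ Hb Kb : GMap Xb Yb (n - 1), Fmap F Hb = H → Fmap F Kb = K →
      ∃ γ : GMap Xb Yb (n - 1), Fmap F γ = 0 ∧
        gdelta dCb dDb (show n - 1 + 1 = n by omega) Kb
            - gdelta dCb dDb (show n - 1 + 1 = n by omega) Hb
          = gdelta dCb dDb (show n - 1 + 1 = n by omega) γ) ∧
    -- (ii) matching lifted homotopies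
    (∀ Hb : GMap Xb Yb (n - 1), Fmap F Hb = H →
      gdelta dCb dDb (show n - 1 + 1 = n by omega) Hb = gb - fb →
      ∃ Kb : GMap Xb Yb (n - 1), Fmap F Kb = K ∧
        gdelta dCb dDb (show n - 1 + 1 = n by omega) Kb = gb - fb ∧
        ∃ Λb : GMap Xb Yb (n - 2), Fmap F Λb = Λ ∧
          gdelta dCb dDb (show n - 2 + 1 = n - 1 by omega) Λb = Kb - Hb) := by
  obtain ⟨Λb, rfl⟩ := exists_Fmap_eq F Λ
  have hδΛ : gdelta dCb dDb (show n - 1 + 1 = n by omega)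
      (gdelta dCb dDb (show n - 2 + 1 = n - 1 by omega) Λb) = 0 :=
    gdelta_gdelta _ hdCbsq hdDbsq _ _ Λb
  have hFΛ : Fmap F (gdelta dCb dDb (show n - 2 + 1 = n - 1 by omega) Λb) = K - H := by
    rw [Fmap_gdelta, hdCb, hdDb, hΛ]
  refine ⟨fun Hb Kb hHb hKb => ?_, fun Hb hHb hδH => ?_⟩
  · refine ⟨Kb - Hb - gdelta dCb dDb (show n - 2 + 1 = n - 1 by omega) Λb, ?_, ?_⟩
    · rw [Fmap_sub, Fmap_sub, hFΛ, hHb, hKb, sub_self]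
    · rw [gdelta_sub, gdelta_sub, hδΛ, sub_zero]
  · refine ⟨Hb + gdelta dCb dDb (show n - 2 + 1 = n - 1 by omega) Λb, ?_, ?_, Λb, rfl, ?_⟩
    · rw [Fmap_add, hFΛ, hHb, add_sub_cancel]
    · rw [gdelta_add, hδΛ, hδH, add_zero]
    · rw [add_sub_cancel_left]

end Paper
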